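/- Let γ ∈ (1,∞) and let n : ℕ → ℕ satisfy n(N) ≥ N + 1 for all N and n(N)/N → γ as N → ∞. For each N ≥ 2, define β̃_N = ((N−1)^{1/4} · (n(N)−1)^{1/4} / (2^{(n(N)−N)/2} · (N−1))) · (Γ((N+1)/2)/Γ(n(N)/2)) · (Γ(n(N)−1)/Γ(N−1))^{1/2}. Then there exist a constant C > 0 and an integer N₀ such that for all N ≥ N₀, |β̃_N − 1/√2| ≤ C/N. -/

import Mathlib

open Real Filter

theorem Gamma_add_half_sq_le {x : ℝ} (hx : 0 < x) :
    Gamma (x + 1 / 2) ^ 2 ≤ x * Gamma x ^ 2 := by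
  have hG := Gamma_pos_of_pos hx
  have h := Gamma_mul_add_mul_le_rpow_Gamma_mul_rpow_Gamma hx (by linarith : 0 < x + 1)
    (by norm_num : (0 : ℝ) < 1 / 2) (by norm_num : (0 : ℝ) < 1 / 2) (by norm_num)
  rw [show 1 / 2 * x + 1 / 2 * (x + 1) = x + 1 / 2 by ring, Gamma_add_one hx.ne',
    ← Real.sqrt_eq_rpow, ← Real.sqrt_eq_rpow] at h
  calc Gamma (x + 1 / 2) ^ 2 ≤ (√(Gamma x) * √(x * Gamma x)) ^ 2 := by gcongr
    _ = x * Gamma x ^ 2 := by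
      rw [mul_pow, sq_sqrt hG.le, sq_sqrt (by positivity)]
      ring

theorem sub_half_mul_Gamma_sq_le {x : ℝ} (hx : 1 / 2 < x) :
    (x - 1 / 2) * Gamma x ^ 2 ≤ Gamma (x + 1 / 2) ^ 2 := by
  have hx' : 0 < x - 1 / 2 := by linarith
  have h := Gamma_add_half_sq_le hx'
  have h2 := Gamma_add_one hx'.ne'
  rw [sub_add_cancel] at h
  rw [show x - 1 / 2 + 1 = x + 1 / 2 by ring] at h2
  calc (x - 1 / 2) * Gamma x ^ 2 ≤ (x - 1 / 2) * ((x - 1 / 2) * Gamma (x - 1 / 2) ^ 2) := by gcongr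
    _ = Gamma (x + 1 / 2) ^ 2 := by
      rw [h2]
      ring

/-- The square of `√x Γ(x) / Γ(x + 1/2)`. -/
noncomputable def gammaHalfRatioSq (x : ℝ) : ℝ := x * Gamma x ^ 2 / Gamma (x + 1 / 2) ^ 2

theorem one_le_gammaHalfRatioSq {x : ℝ} (hx : 0 < x) : 1 ≤ gammaHalfRatioSq x := by
  have := Gamma_pos_of_pos (by linarith : 0 < x + 1 / 2)
  rw [gammaHalfRatioSq, one_le_div (by positivity)]
  exact Gamma_add_half_sq_le hx

theorem gammaHalfRatioSq_le {x : ℝ} (hx : 1 / 2 < x) :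
    gammaHalfRatioSq x ≤ x / (x - 1 / 2) := by
  have := Gamma_pos_of_pos (by linarith : 0 < x + 1 / 2)
  rw [gammaHalfRatioSq, div_le_div_iff₀ (by positivity) (by linarith)]
  nlinarith [sub_half_mul_Gamma_sq_le hx]

/-- The constant `β̃_N`, in terms of `x = (N - 1) / 2` and `y = (n - 1) / 2`. -/
noncomputable def betaTilde (x y : ℝ) : ℝ :=
  (2 * x) ^ ((1 : ℝ) / 4) * (2 * y) ^ ((1 : ℝ) / 4) / ((2 : ℝ) ^ (y - x) * (2 * x)) *
    (Gamma (x + 1) / Gamma (y + 1 / 2)) * (Gamma (2 * y) / Gamma (2 * x)) ^ ((1 : ℝ) / 2)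

theorem betaTilde_pow_four {x y : ℝ} (hx : 0 < x) (hy : 0 < y) :
    betaTilde x y ^ 4 = gammaHalfRatioSq x * gammaHalfRatioSq y / 4 := by
  have root4 : ∀ t : ℝ, 0 < t → (t ^ ((1 : ℝ) / 4)) ^ 4 = t := fun t ht => by
    rw [← rpow_natCast, ← rpow_mul ht.le]
    norm_num
  have root2 : ∀ t : ℝ, 0 < t → (t ^ ((1 : ℝ) / 2)) ^ 4 = t ^ 2 := fun t ht => by
    rw [← rpow_natCast, ← rpow_mul ht.le]
    norm_num
  have hGx := Gamma_pos_of_pos hx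
  have hGy := Gamma_pos_of_pos hy
  have hGx' := Gamma_pos_of_pos (by linarith : 0 < x + 1 / 2)
  have hGy' := Gamma_pos_of_pos (by linarith : 0 < y + 1 / 2)
  have hG2x := Gamma_pos_of_pos (by linarith : 0 < 2 * x)
  have hG2y := Gamma_pos_of_pos (by linarith : 0 < 2 * y)
  have hP : (0 : ℝ) < 2 ^ (y - x) := by positivity
  have hquot : Gamma (2 * y) / Gamma (2 * x) =
      (2 ^ (y - x)) ^ 2 * (Gamma y * Gamma (y + 1 / 2)) / (Gamma x * Gamma (x + 1 / 2)) := by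
    have hpow : (2 : ℝ) ^ (1 - 2 * x) = (2 ^ (y - x)) ^ 2 * 2 ^ (1 - 2 * y) := by
      rw [← rpow_natCast, ← rpow_mul (by norm_num), ← rpow_add (by norm_num)]
      congr 1
      push_cast
      ring
    have hQ : (0 : ℝ) < 2 ^ (1 - 2 * y) := by positivity
    rw [Gamma_mul_Gamma_add_half_of_pos hx, Gamma_mul_Gamma_add_half_of_pos hy, hpow]
    field_simp
  rw [betaTilde, mul_pow, mul_pow, div_pow, mul_pow, root4 _ (by positivity),
    root4 _ (by positivity), root2 _ (by positivity), hquot, Gamma_add_one hx.ne',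
    gammaHalfRatioSq, gammaHalfRatioSq]
  field_simp
  ring

theorem abs_betaTilde_sub_le {x y : ℝ} (hx : 1 / 2 < x) (hxy : x ≤ y) :
    |betaTilde x y - 1 / √2| ≤ 1 / (2 * x - 1) := by
  have hx0 : 0 < x := by linarith
  have hy0 : 0 < y := by linarith
  have hβ : 0 ≤ betaTilde x y := by
    have h1 := Gamma_pos_of_pos (by linarith : 0 < x + 1)
    have h2 := Gamma_pos_of_pos (by linarith : 0 < y + 1 / 2)
    have h3 := Gamma_pos_of_pos (by linarith : 0 < 2 * x)
    have h4 := Gamma_pos_of_pos (by linarith : 0 < 2 * y)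
    unfold betaTilde
    positivity
  have h4 := betaTilde_pow_four hx0 hy0
  have hs : (1 / √2) ^ 4 = 1 / 4 := by
    rw [div_pow, show √2 ^ 4 = (√2 ^ 2) ^ 2 by ring, sq_sqrt (by norm_num)]
    norm_num
  have hs0 : 0 < 1 / √2 := by positivity
  have hs1 : 1 / √2 ≤ 1 := by
    rw [div_le_one (by positivity)]
    exact Real.one_le_sqrt.mpr (by norm_num)
  have hlow : 1 / √2 ≤ betaTilde x y := by
    refine le_of_pow_le_pow_left₀ (n := 4) (by norm_num) hβ ?_
    rw [hs, h4]
    nlinarith [one_le_gammaHalfRatioSq hx0, one_le_gammaHalfRatioSq hy0]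
  set d := 1 / (2 * x - 1)
  have hd0 : 0 < d := one_div_pos.mpr (by linarith)
  have hxd : x / (x - 1 / 2) = 1 + d := by
    have hd1 : d * (2 * x - 1) = 1 := one_div_mul_cancel (by linarith)
    rw [div_eq_iff (by linarith)]
    linarith
  have hGx : gammaHalfRatioSq x ≤ 1 + d := hxd ▸ gammaHalfRatioSq_le hx
  have hGy : gammaHalfRatioSq y ≤ 1 + d := by
    refine (gammaHalfRatioSq_le (by linarith)).trans (hxd ▸ ?_)
    rw [div_le_div_iff₀ (by linarith) (by linarith)]
    nlinarith
  have hup : betaTilde x y ≤ 1 / √2 * (1 + d) := by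
    refine le_of_pow_le_pow_left₀ (n := 4) (by norm_num) (by positivity) ?_
    rw [mul_pow, hs, h4]
    have hprod : gammaHalfRatioSq x * gammaHalfRatioSq y ≤ (1 + d) * (1 + d) :=
      mul_le_mul hGx hGy (by linarith [one_le_gammaHalfRatioSq hy0]) (by linarith)
    have hpow : (1 + d) ^ 2 ≤ (1 + d) ^ 4 := pow_le_pow_right₀ (by linarith) (by norm_num)
    nlinarith
  rw [abs_of_nonneg (by linarith)]
  nlinarith

theorem stmt_4 (γ : ℝ) (hγ : 1 < γ) (n : ℕ → ℕ) (hn : ∀ N, N + 1 ≤ n N)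
    (hlim : Tendsto (fun N : ℕ => (n N : ℝ) / (N : ℝ)) atTop (nhds γ)) :
    ∃ C > 0, ∃ N₀ : ℕ, 2 ≤ N₀ ∧ ∀ N ≥ N₀,
      |((N : ℝ) - 1) ^ ((1 : ℝ) / 4) * ((n N : ℝ) - 1) ^ ((1 : ℝ) / 4) /
            ((2 : ℝ) ^ (((n N : ℝ) - (N : ℝ)) / 2) * ((N : ℝ) - 1)) *
            (Real.Gamma (((N : ℝ) + 1) / 2) / Real.Gamma ((n N : ℝ) / 2)) *
            (Real.Gamma ((n N : ℝ) - 1) / Real.Gamma ((N : ℝ) - 1)) ^ ((1 : ℝ) / 2)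
          - 1 / Real.sqrt 2| ≤ C / N := by
  refine ⟨3, by norm_num, 3, by norm_num, fun N hN => ?_⟩
  have hN3 : (3 : ℝ) ≤ N := by exact_mod_cast hN
  have hnN : (N : ℝ) + 1 ≤ n N := by exact_mod_cast hn N
  have h := abs_betaTilde_sub_le (x := ((N : ℝ) - 1) / 2) (y := ((n N : ℝ) - 1) / 2)
    (by linarith) (by linarith)
  rw [betaTilde, show 2 * (((N : ℝ) - 1) / 2) = (N : ℝ) - 1 by ring,
    show 2 * (((n N : ℝ) - 1) / 2) = (n N : ℝ) - 1 by ring,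
    show ((n N : ℝ) - 1) / 2 - ((N : ℝ) - 1) / 2 = ((n N : ℝ) - N) / 2 by ring,
    show ((N : ℝ) - 1) / 2 + 1 = ((N : ℝ) + 1) / 2 by ring,
    show ((n N : ℝ) - 1) / 2 + 1 / 2 = (n N : ℝ) / 2 by ring] at h
  refine h.trans ?_
  rw [div_le_div_iff₀ (by linarith) (by linarith)]
  linarith
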